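/- Fix integers d ≥ 1 and r ≥ 0. Let f = 1_Ω with Ω = (0, 1/2) × (0,1)^{d−1}, and consider the sampling model with design points x_i = ((i_1 − 1/2)/n, …, (i_d − 1/2)/n), i ∈ {1,…,n}^d, observations y_j = f(x_j) + ε_j with mean-zero noise. Let f̂_i be the LPR estimate of degree r with linear-filter weights ω_{i,j} = 1{‖x_i − x_j‖_∞ ≤ h/2}. Then there exist a constant C > 0 and a threshold T, both depending only on d and r, such that whenever nh ≥ T and i satisfies dist_∞(x_i, ∂Ω) ≤ h/C and B(x_i, h/2) ⊆ (0,1)^d, the squared bias satisfies (E f̂_i − f(x_i))² ≥ 1/C. -/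

import Mathlib

open Set
open scoped BigOperators Classical

noncomputable section

/-- Design points on the grid: `x_i = ((i_1+1/2)/n, …, (i_d+1/2)/n)` for `i : Fin d → Fin n`
(0-based indexing, corresponding to `(i_k - 1/2)/n` for 1-based `i_k`). -/
def dpt (d n : ℕ) (i : Fin d → Fin n) : Fin d → ℝ := fun k => ((i k : ℝ) + 1 / 2) / n

/-- Multi-indices of total degree at most `r`. -/
abbrev MIdx (d r : ℕ) := {s : Fin d → Fin (r + 1) // (∑ k, (s k : ℕ)) ≤ r}

/-- The zero multi-index. -/
def mZero (d r : ℕ) : MIdx d r := ⟨fun _ => 0, by simp⟩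

/-- Monomial associated with a multi-index. -/
def mono {d r : ℕ} (s : MIdx d r) (u : Fin d → ℝ) : ℝ := ∏ k, u k ^ (s.val k : ℕ)

/-- Weighted least-squares objective of local polynomial regression. -/
def lprObj {ι : Type*} [Fintype ι] (d r : ℕ) (x0 : Fin d → ℝ) (pts : ι → Fin d → ℝ)
    (w y : ι → ℝ) (a : MIdx d r → ℝ) : ℝ :=
  ∑ j, w j * (y j - ∑ s : MIdx d r, a s * mono s (pts j - x0)) ^ 2

/-- Local polynomial regression fit at `x0`: the constant coefficient of the unique minimizer
of the weighted least-squares objective; the fallback value if the minimizer is not unique. -/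
def lprFit {ι : Type*} [Fintype ι] (d r : ℕ) (x0 : Fin d → ℝ) (pts : ι → Fin d → ℝ)
    (w y : ι → ℝ) (fb : ℝ) : ℝ :=
  if h : ∃! a : MIdx d r → ℝ, ∀ b : MIdx d r → ℝ,
      lprObj d r x0 pts w y a ≤ lprObj d r x0 pts w y b
  then h.exists.choose (mZero d r) else fb

/-- Polynomial with coefficients `a`. -/
def PP {d r : ℕ} (a : MIdx d r → ℝ) (u : Fin d → ℝ) : ℝ := ∑ s : MIdx d r, a s * mono s u

/-- Integer box. -/
def box (d M : ℕ) : Finset (Fin d → ℤ) := Fintype.piFinset fun _ => Finset.Icc (-(M : ℤ)) M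

/-- Scaled grid point. -/
def gp {d : ℕ} (δ : ℝ) (m : Fin d → ℤ) : Fin d → ℝ := fun k => δ * (m k : ℝ)

lemma mem_box {d M : ℕ} {m : Fin d → ℤ} : m ∈ box d M ↔ ∀ k, -(M : ℤ) ≤ m k ∧ m k ≤ M := by
  simp [box, Fintype.mem_piFinset]

lemma card_box (d M : ℕ) : (box d M).card = (2 * M + 1) ^ d := by
  simp only [box, Fintype.card_piFinset, Int.card_Icc, Finset.prod_const, Finset.card_univ,
    Fintype.card_fin]
  congr 1
  omega

lemma mono_smul {d r : ℕ} (s : MIdx d r) (t : ℝ) (u : Fin d → ℝ) :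
    mono s (fun k => t * u k) = t ^ (∑ k, (s.val k : ℕ)) * mono s u := by
  simp only [mono, mul_pow, Finset.prod_mul_distrib, Finset.prod_pow_eq_pow_sum]

lemma mono_zero {d r : ℕ} (s : MIdx d r) : mono s (0 : Fin d → ℝ) = if s = mZero d r then 1 else 0 := by
  split_ifs with h
  · subst h; simp [mono, mZero]
  · simp only [mono]
    have : ∃ k, s.val k ≠ 0 := by
      by_contra hc
      push Not at hc
      exact h (Subtype.ext (funext hc))
    obtain ⟨k, hk⟩ := this
    apply Finset.prod_eq_zero (Finset.mem_univ k)
    simp only [Pi.zero_apply]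
    apply zero_pow
    intro h0
    exact hk (Fin.ext h0)

lemma PP_zero {d r : ℕ} (a : MIdx d r → ℝ) : PP a 0 = a (mZero d r) := by
  simp [PP, mono_zero]

lemma alt_sum (N j : ℕ) (h : j < N) :
    ∑ k ∈ Finset.range (N + 1), ((-1 : ℝ) ^ (N - k) * N.choose k) * (k : ℝ) ^ j = 0 := by
  have h1 := Polynomial.fwdDiff_iter_eq_zero_of_degree_lt (R := ℝ) (P := Polynomial.X ^ j) (n := N)
    (by simpa using h)
  have h2 := fwdDiff_iter_eq_sum_shift (1 : ℝ) (fun x => (Polynomial.X ^ j : Polynomial ℝ).eval x) N 0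
  have h3 := congrFun h1 0
  rw [show (fun x => (Polynomial.X ^ j : Polynomial ℝ).eval x) = (Polynomial.X ^ j : Polynomial ℝ).eval from rfl, h3] at h2
  simp only [Pi.zero_apply] at h2
  rw [h2]
  apply Finset.sum_congr rfl
  intro k _
  simp

lemma PP_fd {d r : ℕ} (a : MIdx d r → ℝ) (u : Fin d → ℝ) :
    ∑ k ∈ Finset.range (r + 2), ((-1 : ℝ) ^ (r + 1 - k) * (r + 1).choose k) *
      PP a (fun i => (k : ℝ) * u i) = 0 := by
  simp only [PP, mono_smul, Finset.mul_sum]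
  rw [Finset.sum_comm]
  apply Finset.sum_eq_zero
  intro s _
  have := alt_sum (r + 1) (∑ k, (s.val k : ℕ)) (by have := s.2; omega)
  calc _ = (a s * mono s u) * ∑ k ∈ Finset.range (r + 1 + 1),
      ((-1 : ℝ) ^ (r + 1 - k) * (r + 1).choose k) * (k : ℝ) ^ (∑ k, (s.val k : ℕ)) := by
        rw [Finset.mul_sum]; apply Finset.sum_congr rfl; intro k _; ring
    _ = 0 := by rw [this, mul_zero]

lemma PP_zero_le {d r : ℕ} (a : MIdx d r → ℝ) (u : Fin d → ℝ) :
    (PP a 0) ^ 2 ≤ 4 ^ (r + 1) * ∑ k ∈ Finset.range (r + 1), PP a (fun i => ((k + 1 : ℕ) : ℝ) * u i) ^ 2 := by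
  have h := PP_fd a u
  rw [Finset.sum_range_succ'] at h
  simp only [Nat.cast_zero, zero_mul, Nat.choose_zero_right, Nat.cast_one, mul_one, Nat.sub_zero] at h
  change _ + _ * PP a 0 = 0 at h
  set S := ∑ k ∈ Finset.range (r + 1), ((-1 : ℝ) ^ (r + 1 - (k + 1)) * ((r + 1).choose (k + 1) : ℝ)) *
      PP a (fun i => ((k + 1 : ℕ) : ℝ) * u i) with hS
  have h1 : (PP a 0) ^ 2 = S ^ 2 := by
    have h2 : S = - ((-1) ^ (r + 1) * PP a 0) := by linarith
    rw [h2, neg_sq, mul_pow, ← pow_mul, mul_comm (r + 1) 2, pow_mul]; simp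
  rw [h1]
  refine (Finset.sum_mul_sq_le_sq_mul_sq _ _ _).trans ?_
  apply mul_le_mul_of_nonneg_right _ (Finset.sum_nonneg fun _ _ => sq_nonneg _)
  have h3 : ∀ k, ((-1 : ℝ) ^ (r + 1 - (k + 1)) * ((r + 1).choose (k + 1) : ℝ)) ^ 2
      = ((r + 1).choose (k + 1) : ℝ) ^ 2 := by
    intro k
    rw [mul_pow, ← pow_mul, mul_comm _ 2, pow_mul]; simp
  simp only [h3]
  calc _ ≤ (∑ k ∈ Finset.range (r + 1), ((r + 1).choose (k + 1) : ℝ)) ^ 2 :=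
        Finset.sum_sq_le_sq_sum_of_nonneg (fun _ _ => by positivity)
    _ ≤ ((2 : ℝ) ^ (r + 1)) ^ 2 := by
        apply pow_le_pow_left₀ (Finset.sum_nonneg fun _ _ => by positivity)
        have := Nat.sum_range_choose (r + 1)
        rw [Finset.sum_range_succ'] at this
        have h4 : (∑ k ∈ Finset.range (r + 1), (r + 1).choose (k + 1)) ≤ 2 ^ (r + 1) := by omega
        exact_mod_cast h4
    _ = 4 ^ (r + 1) := by rw [← pow_mul, mul_comm, pow_mul]; norm_num

lemma PP_zero_le_sum {d r : ℕ} (a : MIdx d r → ℝ) (δ : ℝ) (M L : ℕ) (hL : (r + 1) * L ≤ M) :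
    (2 * (L : ℝ) + 1) ^ d * (PP a 0) ^ 2 ≤
      (r + 1) * 4 ^ (r + 1) * ∑ m ∈ box d M, PP a (gp δ m) ^ 2 := by
  have h1 : ∑ v ∈ box d L, (PP a 0) ^ 2 ≤ ∑ v ∈ box d L, 4 ^ (r + 1) *
      ∑ k ∈ Finset.range (r + 1), PP a (fun i => ((k + 1 : ℕ) : ℝ) * gp δ v i) ^ 2 :=
    Finset.sum_le_sum fun v _ => PP_zero_le a (gp δ v)
  rw [Finset.sum_const, card_box, nsmul_eq_mul, ← Finset.mul_sum, Finset.sum_comm] at h1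
  push_cast at h1
  refine h1.trans ?_
  have h2 : ∀ k ∈ Finset.range (r + 1), ∑ v ∈ box d L, PP a (fun i => ((k + 1 : ℕ) : ℝ) * gp δ v i) ^ 2
      ≤ ∑ m ∈ box d M, PP a (gp δ m) ^ 2 := by
    intro k hk
    have hk' : k + 1 ≤ r + 1 := by simpa using hk
    have hinj : Function.Injective (fun v : Fin d → ℤ => fun i => ((k : ℤ) + 1) * v i) := by
      intro v w hvw
      funext i
      have := congrFun hvw i
      simp only at this
      exact mul_left_cancel₀ (by positivity) this
    calc _ = ∑ m ∈ (box d L).image (fun v : Fin d → ℤ => fun i => ((k : ℤ) + 1) * v i),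
          PP a (gp δ m) ^ 2 := by
          rw [Finset.sum_image (fun _ _ _ _ h => hinj h)]
          apply Finset.sum_congr rfl
          intro v _
          congr 2
          funext i
          simp only [gp]; push_cast; ring
      _ ≤ _ := by
          apply Finset.sum_le_sum_of_subset_of_nonneg
          · intro m hm
            obtain ⟨v, hv, rfl⟩ := Finset.mem_image.1 hm
            rw [mem_box] at hv ⊢
            intro i
            obtain ⟨h1, h2⟩ := hv i
            have h3 : ((k : ℤ) + 1) * L ≤ M := by
              have : (k + 1) * L ≤ M := (Nat.mul_le_mul_right _ hk').trans hL
              exact_mod_cast this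
            have hk0 : (0 : ℤ) ≤ (k : ℤ) + 1 := by positivity
            have h4 := mul_le_mul_of_nonneg_left h1 hk0
            have h5 := mul_le_mul_of_nonneg_left h2 hk0
            constructor <;> linarith
          · intros; positivity
  have h3 := Finset.sum_le_sum h2
  rw [Finset.sum_const, Finset.card_range, nsmul_eq_mul] at h3
  push_cast at h3
  calc _ ≤ (4 : ℝ) ^ (r + 1) * (((r : ℝ) + 1) * ∑ m ∈ box d M, PP a (gp δ m) ^ 2) := by
        gcongr
    _ = _ := by ring

lemma PP_inj {d r : ℕ} (a : MIdx d r → ℝ) (δ : ℝ) (hδ : δ ≠ 0) (M : ℕ) (hM : r ≤ M)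
    (h : ∀ m ∈ box d M, PP a (gp δ m) = 0) : a = 0 := by
  let e : MIdx d r → (Fin d →₀ ℕ) := fun s => Finsupp.equivFunOnFinite.symm fun k => (s.val k : ℕ)
  have he : Function.Injective e := by
    intro s t hst
    apply Subtype.ext
    funext k
    have := DFunLike.congr_fun hst k
    exact Fin.ext this
  let Q : MvPolynomial (Fin d) ℝ := ∑ s, MvPolynomial.monomial (e s) (a s)
  have hinj : Function.Injective (fun m : ℤ => δ * (m : ℝ)) := by
    intro x y hxy
    have := mul_left_cancel₀ hδ hxy
    exact_mod_cast this
  have hev : ∀ u, MvPolynomial.eval u Q = PP a u := by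
    intro u
    simp only [Q, PP, map_sum, MvPolynomial.eval_monomial]
    apply Finset.sum_congr rfl
    intro s _
    rw [Finsupp.prod_fintype _ _ (by simp)]
    rfl
  have hQ : Q = 0 := by
    apply MvPolynomial.eq_zero_of_eval_zero_at_prod_finset Q
      (fun _ => (Finset.Icc (-(M : ℤ)) M).image (fun m : ℤ => δ * (m : ℝ)))
    · intro i
      rw [Finset.card_image_of_injective _ hinj, Int.card_Icc]
      have : Q.degreeOf i ≤ r := by
        refine (MvPolynomial.degreeOf_sum_le i Finset.univ _).trans ?_
        apply Finset.sup_le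
        intro s _
        by_cases has : a s = 0
        · simp [has]
        · rw [MvPolynomial.degreeOf_monomial_eq _ i has]
          exact Nat.lt_succ_iff.1 (s.val i).2
      omega
    · intro x hx
      have : ∀ i, ∃ m : ℤ, m ∈ Finset.Icc (-(M : ℤ)) M ∧ δ * (m : ℝ) = x i := by
        intro i
        simpa using hx i
      choose m hm hmx using this
      rw [hev]
      have hx' : x = gp δ m := funext fun i => (hmx i).symm
      rw [hx']
      exact h m (mem_box.2 fun k => Finset.mem_Icc.1 (hm k))
  funext s
  have := congrArg (MvPolynomial.coeff (e s)) hQ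
  simpa [Q, MvPolynomial.coeff_sum, MvPolynomial.coeff_monomial, he.eq_iff] using this

lemma PP_add {d r : ℕ} (a b : MIdx d r → ℝ) (u) : PP (a + b) u = PP a u + PP b u := by
  simp [PP, add_mul, Finset.sum_add_distrib]

lemma PP_smul {d r : ℕ} (c : ℝ) (b : MIdx d r → ℝ) (u) : PP (c • b) u = c * PP b u := by
  simp [PP, Finset.mul_sum, mul_assoc]

lemma PP_single {d r : ℕ} (s : MIdx d r) (u) : PP (Pi.single s 1) u = mono s u := by
  simp [PP, Pi.single_apply]

/-- Normal equations have a solution. -/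
lemma exists_normal (d r : ℕ) (δ : ℝ) (hδ : δ ≠ 0) (M : ℕ) (hM : r ≤ M) (Y : (Fin d → ℤ) → ℝ) :
    ∃ a : MIdx d r → ℝ, ∀ b : MIdx d r → ℝ,
      ∑ m ∈ box d M, (Y m - PP a (gp δ m)) * PP b (gp δ m) = 0 := by
  let N : (MIdx d r → ℝ) →ₗ[ℝ] (MIdx d r → ℝ) :=
    { toFun := fun a s => ∑ m ∈ box d M, PP a (gp δ m) * mono s (gp δ m)
      map_add' := by
        intro a b; funext s
        simp [PP_add, add_mul, Finset.sum_add_distrib]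
      map_smul' := by
        intro c a; funext s
        simp [PP_smul, Finset.mul_sum, mul_assoc] }
  have key : ∀ (Z : (Fin d → ℤ) → ℝ) (b : MIdx d r → ℝ),
      ∑ m ∈ box d M, Z m * PP b (gp δ m) = ∑ s, b s * ∑ m ∈ box d M, Z m * mono s (gp δ m) := by
    intro Z b
    simp only [PP, Finset.mul_sum]
    rw [Finset.sum_comm]
    apply Finset.sum_congr rfl; intro s _
    apply Finset.sum_congr rfl; intro m _
    ring
  have hNinj : Function.Injective N := by
    rw [← LinearMap.ker_eq_bot, LinearMap.ker_eq_bot']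
    intro a ha
    apply PP_inj a δ hδ M hM
    have h1 := key (fun m => PP a (gp δ m)) a
    have h2 : ∀ s, ∑ m ∈ box d M, PP a (gp δ m) * mono s (gp δ m) = 0 := fun s => congrFun ha s
    simp only [h2, mul_zero, Finset.sum_const_zero] at h1
    rw [Finset.sum_eq_zero_iff_of_nonneg (fun _ _ => mul_self_nonneg _)] at h1
    intro m hm
    exact mul_self_eq_zero.1 (h1 m hm)
  obtain ⟨a, ha⟩ := (LinearMap.injective_iff_surjective.1 hNinj)
    (fun s => ∑ m ∈ box d M, Y m * mono s (gp δ m))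
  refine ⟨a, fun b => ?_⟩
  rw [key]
  apply Finset.sum_eq_zero
  intro s _
  have : ∑ m ∈ box d M, PP a (gp δ m) * mono s (gp δ m) = _ := congrFun ha s
  simp only [sub_mul, Finset.sum_sub_distrib, this, sub_self, mul_zero]

lemma normal_min {d r : ℕ} {δ : ℝ} {M : ℕ} {Y : (Fin d → ℤ) → ℝ} {a : MIdx d r → ℝ}
    (ha : ∀ b : MIdx d r → ℝ, ∑ m ∈ box d M, (Y m - PP a (gp δ m)) * PP b (gp δ m) = 0)
    (b : MIdx d r → ℝ) :
    ∑ m ∈ box d M, (Y m - PP b (gp δ m)) ^ 2 = ∑ m ∈ box d M, (Y m - PP a (gp δ m)) ^ 2 +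
      ∑ m ∈ box d M, (PP (b + (-1 : ℝ) • a) (gp δ m)) ^ 2 := by
  have h := ha (b + (-1 : ℝ) • a)
  have h2 : ∑ m ∈ box d M, (Y m - PP b (gp δ m)) ^ 2 = ∑ m ∈ box d M, (Y m - PP a (gp δ m)) ^ 2 +
      ∑ m ∈ box d M, (PP (b + (-1 : ℝ) • a) (gp δ m)) ^ 2 - 2 *
        ∑ m ∈ box d M, (Y m - PP a (gp δ m)) * PP (b + (-1 : ℝ) • a) (gp δ m) := by
    rw [Finset.mul_sum, ← Finset.sum_add_distrib, ← Finset.sum_sub_distrib]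
    apply Finset.sum_congr rfl
    intro m _
    rw [PP_add, PP_smul]; ring
  rw [h2, h]; ring

lemma sum_box_neg {d M : ℕ} (F : (Fin d → ℤ) → ℝ) :
    ∑ m ∈ box d M, F (-m) = ∑ m ∈ box d M, F m := by
  apply Finset.sum_nbij' (fun m => -m) (fun m => -m)
  · intro m hm
    rw [mem_box] at hm ⊢
    intro k; have := hm k; simp only [Pi.neg_apply]; omega
  · intro m hm
    rw [mem_box] at hm ⊢
    intro k; have := hm k; simp only [Pi.neg_apply]; omega
  · simp
  · simp
  · simp

lemma core {d r : ℕ} {δ : ℝ} {M L : ℕ} (hL : (r + 1) * L ≤ M)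
    {Y : (Fin d → ℤ) → ℝ} {a : MIdx d r → ℝ}
    (ha : ∀ b : MIdx d r → ℝ, ∑ m ∈ box d M, (Y m - PP a (gp δ m)) * PP b (gp δ m) = 0) :
    (2 * (L : ℝ) + 1) ^ d * (a (mZero d r) - 1 / 2) ^ 2 ≤
      (r + 1) * 4 ^ (r + 1) * ∑ m ∈ box d M, ((Y m + Y (-m)) / 2 - 1 / 2) ^ 2 := by
  let q : MIdx d r → ℝ := fun s =>
    (a s + (-1) ^ (∑ k, (s.val k : ℕ)) * a s) / 2 + (-(1 / 2)) * (Pi.single (mZero d r) (1 : ℝ) : MIdx d r → ℝ) s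
  have hmneg : ∀ (s : MIdx d r) m, mono s (gp δ (-m)) = (-1) ^ (∑ k, (s.val k : ℕ)) * mono s (gp δ m) := by
    intro s m
    rw [← mono_smul]
    congr 1
    funext k; simp [gp]
  have hm0 : ∀ u, mono (mZero d r) u = 1 := by intro u; simp [mono, mZero]
  have hq : ∀ m, PP q (gp δ m) = (PP a (gp δ m) + PP a (gp δ (-m))) / 2 - 1 / 2 := by
    intro m
    have h1 : PP q (gp δ m) = ∑ s, ((a s * mono s (gp δ m) + a s * mono s (gp δ (-m))) / 2
        + (-(1 / 2)) * ((Pi.single (mZero d r) (1 : ℝ) : MIdx d r → ℝ) s * mono s (gp δ m))) := by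
      apply Finset.sum_congr rfl
      intro s _
      rw [hmneg]; simp only [q]; ring
    rw [h1, Finset.sum_add_distrib, ← Finset.mul_sum, ← Finset.sum_div, Finset.sum_add_distrib]
    change _ + _ * PP _ _ = _
    rw [PP_single, hm0]; simp only [PP]; ring
  have hqneg : ∀ m, PP q (gp δ (-m)) = PP q (gp δ m) := by
    intro m; rw [hq, hq, neg_neg]; ring
  have hq0 : PP q 0 = a (mZero d r) - 1 / 2 := by
    rw [PP_zero]
    simp [q, mZero]; ring
  have h1 := ha q
  have h2 : ∑ m ∈ box d M, (Y (-m) - PP a (gp δ (-m))) * PP q (gp δ m) = 0 := by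
    rw [← h1, ← sum_box_neg]
    apply Finset.sum_congr rfl
    intro m _
    rw [neg_neg, hqneg]
  have h3 : ∑ m ∈ box d M, (((Y m + Y (-m)) / 2 - 1 / 2) - PP q (gp δ m)) * PP q (gp δ m) = 0 := by
    have : ∑ m ∈ box d M, (((Y m + Y (-m)) / 2 - 1 / 2) - PP q (gp δ m)) * PP q (gp δ m) =
      (∑ m ∈ box d M, (Y m - PP a (gp δ m)) * PP q (gp δ m) +
        ∑ m ∈ box d M, (Y (-m) - PP a (gp δ (-m))) * PP q (gp δ m)) / 2 := by
      rw [← Finset.sum_add_distrib, Finset.sum_div]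
      apply Finset.sum_congr rfl
      intro m _
      have := hq m
      have h5 : (((Y m + Y (-m)) / 2 - 1 / 2) - PP q (gp δ m))
        = ((Y m - PP a (gp δ m)) + (Y (-m) - PP a (gp δ (-m)))) / 2 := by rw [this]; ring
      rw [h5]; ring
    rw [this, h1, h2]; simp
  have h4 : ∑ m ∈ box d M, PP q (gp δ m) ^ 2 ≤ ∑ m ∈ box d M, ((Y m + Y (-m)) / 2 - 1 / 2) ^ 2 := by
    have h5 : ∑ m ∈ box d M, ((Y m + Y (-m)) / 2 - 1 / 2) ^ 2 =
      ∑ m ∈ box d M, PP q (gp δ m) ^ 2 + ∑ m ∈ box d M, (((Y m + Y (-m)) / 2 - 1 / 2) - PP q (gp δ m)) ^ 2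
      + 2 * ∑ m ∈ box d M, (((Y m + Y (-m)) / 2 - 1 / 2) - PP q (gp δ m)) * PP q (gp δ m) := by
      rw [Finset.mul_sum, ← Finset.sum_add_distrib, ← Finset.sum_add_distrib]
      apply Finset.sum_congr rfl
      intro m _
      ring
    rw [h5, h3]
    have : 0 ≤ ∑ m ∈ box d M, (((Y m + Y (-m)) / 2 - 1 / 2) - PP q (gp δ m)) ^ 2 :=
      Finset.sum_nonneg fun _ _ => sq_nonneg _
    linarith
  have h6 := PP_zero_le_sum q δ M L hL
  rw [hq0] at h6
  refine h6.trans ?_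
  gcongr

lemma sum_slab {d M : ℕ} (hd : 1 ≤ d) (θ : ℝ) :
    ∑ m ∈ box d M, (((if (m ⟨0, hd⟩ : ℝ) < θ then (1 : ℝ) else 0) +
      (if ((-m) ⟨0, hd⟩ : ℝ) < θ then (1 : ℝ) else 0)) / 2 - 1 / 2) ^ 2 ≤
      1 / 4 * ((2 * |θ| + 1) * (2 * (M : ℝ) + 1) ^ (d - 1)) := by
  obtain ⟨d, rfl⟩ : ∃ d', d = d' + 1 := ⟨d - 1, by omega⟩
  set K := ⌊|θ|⌋₊ with hK
  have hKle : (K : ℝ) ≤ |θ| := Nat.floor_le (abs_nonneg _)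
  let S : Finset (Fin (d + 1) → ℤ) := Fintype.piFinset (Fin.cons (Finset.Icc (-(K : ℤ)) K)
    (fun _ => Finset.Icc (-(M : ℤ)) M))
  have hS : S.card = (2 * K + 1) * (2 * M + 1) ^ d := by
    simp only [S, Fintype.card_piFinset, Fin.prod_univ_succ, Fin.cons_zero, Fin.cons_succ, Int.card_Icc,
      Finset.prod_const, Finset.card_univ, Fintype.card_fin]
    congr 2 <;> omega
  have h1 : ∀ m ∈ box (d + 1) M, (((if (m ⟨0, hd⟩ : ℝ) < θ then (1 : ℝ) else 0) +
      (if ((-m) ⟨0, hd⟩ : ℝ) < θ then (1 : ℝ) else 0)) / 2 - 1 / 2) ^ 2 ≤ if m ∈ S then 1 / 4 else 0 := by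
    intro m hm
    rw [mem_box] at hm
    by_cases hmS : m ∈ S
    · rw [if_pos hmS]; split_ifs <;> norm_num
    · rw [if_neg hmS]
      have h2 : |θ| < |(m 0 : ℝ)| := by
        by_contra hc
        push Not at hc
        apply hmS
        simp only [S, Fintype.mem_piFinset]
        intro k
        refine Fin.cases ?_ (fun k => ?_) k
        · simp only [Fin.cons_zero, Finset.mem_Icc]
          have h3 : (m 0).natAbs ≤ K := by
            rw [hK]
            apply Nat.le_floor
            rw [Nat.cast_natAbs]; push_cast; exact hc
          omega
        · simp only [Fin.cons_succ, Finset.mem_Icc]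
          exact hm _
      have hz : (⟨0, hd⟩ : Fin (d + 1)) = 0 := rfl
      simp only [hz, Pi.neg_apply, Int.cast_neg]
      rcases abs_cases θ with ⟨e1, _⟩ | ⟨e1, _⟩ <;> rcases abs_cases (m 0 : ℝ) with ⟨e2, _⟩ | ⟨e2, _⟩ <;>
        rw [e1, e2] at h2 <;> split_ifs <;> first | (exfalso; linarith) | norm_num
  refine (Finset.sum_le_sum h1).trans ?_
  rw [← Finset.sum_filter, Finset.sum_const, nsmul_eq_mul]
  have h2 : ((box (d + 1) M).filter (· ∈ S)).card ≤ S.card :=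
    Finset.card_le_card fun m hm => (Finset.mem_filter.1 hm).2
  rw [hS] at h2
  have h3 : (((box (d + 1) M).filter (· ∈ S)).card : ℝ) ≤ (2 * (K : ℝ) + 1) * (2 * (M : ℝ) + 1) ^ d := by
    exact_mod_cast h2
  have h4 : (2 * (K : ℝ) + 1) * (2 * (M : ℝ) + 1) ^ d ≤ (2 * |θ| + 1) * (2 * (M : ℝ) + 1) ^ d := by
    gcongr
  simp only [Nat.add_sub_cancel]
  linarith

/-- Reindexing of the window sum. -/
lemma reindex {d n : ℕ} {h : ℝ} (hn : 0 < n) (hh : 0 < h) (i : Fin d → Fin n)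
    (hball : Metric.ball (dpt d n i) (h / 2) ⊆ {z : Fin d → ℝ | ∀ k, z k ∈ Set.Ioo (0 : ℝ) 1})
    (G : (Fin d → Fin n) → ℝ) (G' : (Fin d → ℤ) → ℝ)
    (hG : ∀ j, G j = G' (fun k => (j k : ℤ) - (i k : ℤ))) :
    ∑ j, (if dist (dpt d n i) (dpt d n j) ≤ h / 2 then (1 : ℝ) else 0) * G j =
      ∑ m ∈ box d ⌊(n : ℝ) * h / 2⌋₊, G' m := by
  have hn' : (0 : ℝ) < n := by exact_mod_cast hn
  have hx : 0 ≤ (n : ℝ) * h / 2 := by positivity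
  set M := ⌊(n : ℝ) * h / 2⌋₊ with hM
  have hMle : (M : ℝ) ≤ (n : ℝ) * h / 2 := Nat.floor_le hx
  have hmem : ∀ j, dist (dpt d n i) (dpt d n j) ≤ h / 2 ↔
      (fun k => (j k : ℤ) - (i k : ℤ)) ∈ box d M := by
    intro j
    rw [dist_pi_le_iff (by positivity), mem_box]
    apply forall_congr'
    intro k
    have e : dist (dpt d n i k) (dpt d n j k) = (((j k : ℤ) - (i k : ℤ)).natAbs : ℝ) / n := by
      rw [Real.dist_eq, Nat.cast_natAbs]
      simp only [dpt]
      rw [← sub_div, abs_div, abs_of_pos hn', abs_sub_comm]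
      push_cast
      congr 2
      ring
    rw [e, div_le_iff₀ hn', show h / 2 * n = (n : ℝ) * h / 2 by ring, ← Nat.le_floor_iff hx]
    omega
  have hin : ∀ m ∈ box d M, ∀ k, 0 ≤ (i k : ℤ) + m k ∧ (i k : ℤ) + m k < n := by
    intro m hm k
    rw [mem_box] at hm
    have hb : ∀ t : ℝ, |t| < h / 2 → (((i k : ℕ) : ℝ) + 1 / 2) / n + t ∈ Set.Ioo (0 : ℝ) 1 := by
      intro t ht
      have : (fun k => dpt d n i k + t) ∈ Metric.ball (dpt d n i) (h / 2) := by
        rw [Metric.mem_ball, dist_pi_lt_iff (by positivity)]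
        intro k
        simpa [Real.dist_eq] using ht
      exact hball this k
    have hik : ((i k : ℕ) : ℝ) + 1 ≤ n := by exact_mod_cast (i k).2
    have hik0 : (0 : ℝ) ≤ ((i k : ℕ) : ℝ) := by positivity
    constructor
    · by_contra hc
      push Not at hc
      have h1 := (hm k).1
      have h2 : ((i k : ℕ) : ℤ) + 1 ≤ M := by omega
      have h3 : ((i k : ℕ) : ℝ) + 1 ≤ M := by exact_mod_cast h2
      have h4 := (hb (-((((i k : ℕ) : ℝ) + 1 / 2) / n)) (by
        rw [abs_neg, abs_of_nonneg (by positivity), div_lt_iff₀ hn']; linarith)).1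
      linarith
    · by_contra hc
      push Not at hc
      have h1 := (hm k).2
      have h2 : (n : ℤ) ≤ (i k : ℕ) + M := by omega
      have h3 : (n : ℝ) ≤ (i k : ℕ) + M := by exact_mod_cast h2
      have h4 := (hb (1 - ((((i k : ℕ) : ℝ) + 1 / 2) / n)) (by
        have e : 1 - ((((i k : ℕ) : ℝ) + 1 / 2) / n) = (n - ((i k : ℕ) : ℝ) - 1 / 2) / n := by
          field_simp; ring
        rw [e, abs_of_nonneg (div_nonneg (by linarith) hn'.le), div_lt_iff₀ hn']; linarith)).2
      linarith
  simp only [ite_mul, one_mul, zero_mul]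
  rw [← Finset.sum_filter]
  symm
  refine Finset.sum_bij' (fun m hm => fun k => (⟨((i k : ℤ) + m k).toNat, by have := hin m hm k; omega⟩ : Fin n))
    (fun j _ => fun k => (j k : ℤ) - (i k : ℤ)) ?_ ?_ ?_ ?_ ?_
  · intro m hm
    rw [Finset.mem_filter]
    refine ⟨Finset.mem_univ _, (hmem _).2 ?_⟩
    convert hm using 1
    funext k
    have := hin m hm k
    simp only; omega
  · intro j hj
    exact (hmem j).1 (Finset.mem_filter.1 hj).2
  · intro m hm
    funext k
    have := hin m hm k
    simp only; omega
  · intro j hj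
    funext k
    apply Fin.ext
    simp
  · intro m hm
    rw [hG]
    congr 1
    funext k
    have := hin m hm k
    simp only; omega

lemma frontier_step {d : ℕ} (hd : 1 ≤ d) {x : Fin d → ℝ} {h ε : ℝ} (hε : ε < h / 2)
    {Ωs : Set (Fin d → ℝ)}
    (hΩ : Ωs = {z : Fin d → ℝ | z ⟨0, hd⟩ ∈ Set.Ioo (0 : ℝ) (1 / 2) ∧
            ∀ k, k ≠ ⟨0, hd⟩ → z k ∈ Set.Ioo (0 : ℝ) 1})
    (hx : Metric.infDist x (frontier Ωs) ≤ ε)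
    (hball : Metric.ball x (h / 2) ⊆ {z : Fin d → ℝ | ∀ k, z k ∈ Set.Ioo (0 : ℝ) 1}) :
    |x ⟨0, hd⟩ - 1 / 2| ≤ ε := by
  have hopen : IsOpen Ωs := by
    have hE : Ωs = ((fun z : Fin d → ℝ => z ⟨0, hd⟩) ⁻¹' Set.Ioo (0 : ℝ) (1 / 2)) ∩
        ⋂ k, ⋂ (_ : k ≠ ⟨0, hd⟩), (fun z : Fin d → ℝ => z k) ⁻¹' Set.Ioo (0 : ℝ) 1 := by
      rw [hΩ]; ext z
      simp only [Set.mem_inter_iff, Set.mem_iInter, Set.mem_preimage]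
      rfl
    rw [hE]
    apply IsOpen.inter
    · exact isOpen_Ioo.preimage (continuous_apply _)
    · apply isOpen_iInter_of_finite; intro k
      apply isOpen_iInter_of_finite; intro _
      exact isOpen_Ioo.preimage (continuous_apply k)
  have hne : (frontier Ωs).Nonempty := by
    rw [nonempty_frontier_iff]
    constructor
    · refine ⟨fun _ => 1 / 4, ?_⟩
      rw [hΩ]
      refine ⟨by norm_num, fun k _ => by norm_num⟩
    · intro hu
      have : (fun _ => 1 : Fin d → ℝ) ∈ Ωs := by rw [hu]; trivial
      rw [hΩ] at this
      have := this.1.2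
      norm_num at this
  obtain ⟨y, hy, hxy⟩ := isClosed_frontier.exists_infDist_eq_dist hne x
  rw [hxy] at hx
  have hyb := hball (show y ∈ Metric.ball x (h / 2) by
    rw [Metric.mem_ball, dist_comm]; linarith)
  rw [hopen.frontier_eq] at hy
  have h1 : y ⟨0, hd⟩ ≤ 1 / 2 := by
    have hcl : IsClosed {z : Fin d → ℝ | z ⟨0, hd⟩ ≤ 1 / 2} :=
      isClosed_le (continuous_apply _) continuous_const
    exact (closure_minimal (fun z hz => by rw [hΩ] at hz; exact hz.1.2.le) hcl) hy.1
  have h2 : 1 / 2 ≤ y ⟨0, hd⟩ := by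
    by_contra hc
    push Not at hc
    apply hy.2
    rw [hΩ]
    exact ⟨⟨(hyb _).1, hc⟩, fun k _ => hyb k⟩
  have h3 : y ⟨0, hd⟩ = 1 / 2 := le_antisymm h1 h2
  have h4 := dist_le_pi_dist x y ⟨0, hd⟩
  rw [h3, Real.dist_eq] at h4
  linarith

/-- bias of linear filtering near the discontinuity.
Let `f = 1_Ω` with `Ω = (0,1/2)×(0,1)^{d-1}`, and let `f̂_i` be the (noiseless) LPR fit of
degree `r` with linear-filter weights `ω_{i,j} = 1{‖x_i − x_j‖_∞ ≤ h/2}`. There are `C > 0`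
and a threshold `T` (both depending only on `d, r`) such that whenever `nh ≥ T`,
`dist_∞(x_i, ∂Ω) ≤ h/C` and `B(x_i, h/2) ⊆ (0,1)^d`, the squared bias is at least `1/C`. -/
theorem lpr_bias_lower_bound_linear_filter
    (d r : ℕ) (hd : 1 ≤ d) :
    ∃ C T : ℝ, 0 < C ∧ 0 < T ∧
      ∀ (n : ℕ) (h : ℝ), 0 < h → T ≤ (n : ℝ) * h →
        ∀ (Ωs : Set (Fin d → ℝ)),
          Ωs = {z : Fin d → ℝ | z ⟨0, hd⟩ ∈ Set.Ioo (0 : ℝ) (1 / 2) ∧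
            ∀ k, k ≠ ⟨0, hd⟩ → z k ∈ Set.Ioo (0 : ℝ) 1} →
          ∀ f : (Fin d → ℝ) → ℝ, (∀ z, f z = if z ∈ Ωs then 1 else 0) →
            ∀ i : Fin d → Fin n,
              Metric.infDist (dpt d n i) (frontier Ωs) ≤ h / C →
              Metric.ball (dpt d n i) (h / 2) ⊆
                {z : Fin d → ℝ | ∀ k, z k ∈ Set.Ioo (0 : ℝ) 1} →
              1 / C ≤
                (lprFit d r (dpt d n i) (dpt d n)
                    (fun j => if dist (dpt d n i) (dpt d n j) ≤ h / 2 then 1 else 0)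
                    (fun j => f (dpt d n j)) (f (dpt d n i)) -
                  f (dpt d n i)) ^ 2 := by
  set A : ℝ := (r + 1) * 4 ^ (r + 1) * (2 * r + 2) ^ d with hA
  have hA0 : 0 < A := by positivity
  refine ⟨24 * A + 2 * r + 16, 24 * A + 2 * r + 16, by positivity, by positivity, ?_⟩
  set C : ℝ := 24 * A + 2 * r + 16 with hC
  have hr0 : (0 : ℝ) ≤ r := by positivity
  have hC16 : 16 ≤ C := by linarith
  have hC0 : 0 < C := by linarith
  intro n h hh hT Ωs hΩ f hf i hdist hball
  have hn : 0 < n := by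
    rcases Nat.eq_zero_or_pos n with h0 | h0
    · subst h0; simp at hT; linarith
    · exact h0
  have hn' : (0 : ℝ) < n := by exact_mod_cast hn
  have hx0 := frontier_step hd (h := h) (ε := h / C)
    (by rw [div_lt_div_iff₀ hC0 two_pos]; nlinarith) hΩ hdist hball
  set δ : ℝ := 1 / n with hδ
  have hδ0 : δ ≠ 0 := by positivity
  set θ : ℝ := n * (1 / 2 - dpt d n i ⟨0, hd⟩) with hθ
  have hθle : |θ| ≤ n * h / C := by
    rw [hθ, abs_mul, abs_of_pos hn', abs_sub_comm, mul_div_assoc]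
    gcongr
  set M := ⌊(n : ℝ) * h / 2⌋₊ with hM
  have hMlt : (n : ℝ) * h / 2 < M + 1 := Nat.lt_floor_add_one _
  have hrM : r ≤ M := by
    have : (r : ℝ) < (M : ℝ) + 1 := by linarith
    have : r < M + 1 := by exact_mod_cast this
    omega
  set L := M / (r + 1) with hLdef
  have hL : (r + 1) * L ≤ M := Nat.mul_div_le M (r + 1)
  have hLM : 2 * (M : ℝ) + 1 ≤ (2 * r + 2) * (2 * L + 1) := by
    have h1 : M < (r + 1) * (L + 1) := by
      rw [hLdef]; exact Nat.lt_mul_div_succ M (Nat.succ_pos r)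
    have h2 : 2 * M + 1 ≤ (2 * r + 2) * (2 * L + 1) := by nlinarith
    exact_mod_cast h2
  let Y : (Fin d → ℤ) → ℝ := fun m => if (m ⟨0, hd⟩ : ℝ) < θ then 1 else 0
  have hpt : ∀ j : Fin d → Fin n, ∀ k, dpt d n j k ∈ Set.Ioo (0 : ℝ) 1 := by
    intro j k
    have hjk : ((j k : ℕ) : ℝ) + 1 ≤ n := by exact_mod_cast (j k).2
    simp only [dpt]
    constructor
    · positivity
    · rw [div_lt_one hn']; linarith
  have hfj : ∀ j : Fin d → Fin n, f (dpt d n j) = Y (fun k => (j k : ℤ) - (i k : ℤ)) := by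
    intro j
    rw [hf]
    have hiff : dpt d n j ∈ Ωs ↔ (((j ⟨0, hd⟩ : ℤ) - (i ⟨0, hd⟩ : ℤ) : ℤ) : ℝ) < θ := by
      have e : θ - (((j ⟨0, hd⟩ : ℤ) - (i ⟨0, hd⟩ : ℤ) : ℤ) : ℝ) = n * (1 / 2 - dpt d n j ⟨0, hd⟩) := by
        rw [hθ]; simp only [dpt]; push_cast; field_simp; ring
      have e2 : dpt d n j ∈ Ωs ↔ dpt d n j ⟨0, hd⟩ < 1 / 2 := by
        rw [hΩ]
        exact ⟨fun hz => hz.1.2, fun hz => ⟨⟨(hpt j _).1, hz⟩, fun k _ => hpt j k⟩⟩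
      rw [e2, ← sub_pos, ← sub_pos (b := ((_ : ℤ) : ℝ)), e, mul_pos_iff_of_pos_left hn']
    simp only [Y, hiff]
  have hobj : ∀ b : MIdx d r → ℝ, lprObj d r (dpt d n i) (dpt d n)
      (fun j => if dist (dpt d n i) (dpt d n j) ≤ h / 2 then 1 else 0)
      (fun j => f (dpt d n j)) b = ∑ m ∈ box d M, (Y m - PP b (gp δ m)) ^ 2 := by
    intro b
    simp only [lprObj]
    apply reindex hn hh i hball
    intro j
    rw [hfj]
    simp only [PP]
    congr 2
    apply Finset.sum_congr rfl
    intro s _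
    congr 2
    funext k
    simp only [gp, dpt, Pi.sub_apply, hδ]
    push_cast
    field_simp
    ring
  obtain ⟨a, ha⟩ := exists_normal d r δ hδ0 M hrM Y
  have hmin : ∀ b : MIdx d r → ℝ, ∑ m ∈ box d M, (Y m - PP a (gp δ m)) ^ 2 ≤
      ∑ m ∈ box d M, (Y m - PP b (gp δ m)) ^ 2 := by
    intro b
    rw [normal_min ha b]
    have : 0 ≤ ∑ m ∈ box d M, (PP (b + (-1 : ℝ) • a) (gp δ m)) ^ 2 :=
      Finset.sum_nonneg fun _ _ => sq_nonneg _
    linarith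
  have huniq : ∀ b : MIdx d r → ℝ, (∀ c : MIdx d r → ℝ, ∑ m ∈ box d M, (Y m - PP b (gp δ m)) ^ 2 ≤
      ∑ m ∈ box d M, (Y m - PP c (gp δ m)) ^ 2) → b = a := by
    intro b hb
    have h1 := hb a
    rw [normal_min ha b] at h1
    have h0 : 0 ≤ ∑ m ∈ box d M, (PP (b + (-1 : ℝ) • a) (gp δ m)) ^ 2 :=
      Finset.sum_nonneg fun _ _ => sq_nonneg _
    have h2 : ∑ m ∈ box d M, (PP (b + (-1 : ℝ) • a) (gp δ m)) ^ 2 = 0 := by linarith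
    rw [Finset.sum_eq_zero_iff_of_nonneg (fun _ _ => sq_nonneg _)] at h2
    have h3 := PP_inj _ δ hδ0 M hrM (fun m hm => pow_eq_zero_iff two_ne_zero |>.1 (h2 m hm))
    funext s
    have := congrFun h3 s
    simp at this
    linarith
  have hfit : lprFit d r (dpt d n i) (dpt d n)
      (fun j => if dist (dpt d n i) (dpt d n j) ≤ h / 2 then 1 else 0)
      (fun j => f (dpt d n j)) (f (dpt d n i)) = a (mZero d r) := by
    have hex : ∃! a : MIdx d r → ℝ, ∀ b : MIdx d r → ℝ,
      lprObj d r (dpt d n i) (dpt d n)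
        (fun j => if dist (dpt d n i) (dpt d n j) ≤ h / 2 then 1 else 0)
        (fun j => f (dpt d n j)) a ≤ lprObj d r (dpt d n i) (dpt d n)
        (fun j => if dist (dpt d n i) (dpt d n j) ≤ h / 2 then 1 else 0)
        (fun j => f (dpt d n j)) b := by
      refine ⟨a, ?_, ?_⟩
      · intro b
        rw [hobj, hobj]; exact hmin b
      · intro b hb
        apply huniq
        intro c
        have := hb c
        rwa [hobj, hobj] at this
    unfold lprFit
    rw [dif_pos hex]
    have hch := hex.exists.choose_spec
    have : hex.exists.choose = a := by
      apply huniq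
      intro c
      have := hch c
      rwa [hobj, hobj] at this
    rw [this]
  rw [hfit]
  have hcore := core (δ := δ) hL ha
  have hslab := sum_slab (M := M) hd θ
  simp only [Pi.neg_apply, Int.cast_neg] at hslab
  simp only [Y, Pi.neg_apply, Int.cast_neg] at hcore
  set e := a (mZero d r) - 1 / 2 with he
  have hbd : e ^ 2 ≤ 1 / 16 := by
    have hLpos : (0 : ℝ) < (2 * (L : ℝ) + 1) ^ d := by positivity
    have hMpos : (0 : ℝ) < (2 * (M : ℝ) + 1) ^ d := by positivity
    have hc0 : (0 : ℝ) ≤ (r + 1) * 4 ^ (r + 1) := by positivity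
    have h1 := hcore.trans (mul_le_mul_of_nonneg_left hslab hc0)
    have h2 : (2 * (M : ℝ) + 1) ^ d ≤ (2 * r + 2) ^ d * (2 * L + 1) ^ d := by
      rw [← mul_pow]; gcongr
    have h3 : 24 * A * (2 * |θ| + 1) ≤ 6 * (2 * (M : ℝ) + 1) := by
      have h4 : 24 * A * |θ| ≤ n * h := by
        calc 24 * A * |θ| ≤ C * (n * h / C) := by
              apply mul_le_mul _ hθle (abs_nonneg _) hC0.le
              linarith
          _ = n * h := by field_simp
      have : 24 * A ≤ n * h := by linarith
      linarith
    have h5 : (2 * (M : ℝ) + 1) ^ d = (2 * (M : ℝ) + 1) ^ (d - 1) * (2 * (M : ℝ) + 1) := by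
      rw [← pow_succ]; congr 1; omega
    have h6 : (2 * (M : ℝ) + 1) ^ d * e ^ 2 ≤ (2 * (M : ℝ) + 1) ^ d * (1 / 16) := by
      calc (2 * (M : ℝ) + 1) ^ d * e ^ 2 ≤ ((2 * r + 2) ^ d * (2 * L + 1) ^ d) * e ^ 2 := by gcongr
        _ = (2 * r + 2) ^ d * ((2 * L + 1) ^ d * e ^ 2) := by ring
        _ ≤ (2 * r + 2) ^ d * ((r + 1) * 4 ^ (r + 1) *
            (1 / 4 * ((2 * |θ| + 1) * (2 * (M : ℝ) + 1) ^ (d - 1)))) := by gcongr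
        _ = (24 * A * (2 * |θ| + 1)) / 96 * (2 * (M : ℝ) + 1) ^ (d - 1) := by rw [hA]; ring
        _ ≤ (6 * (2 * (M : ℝ) + 1)) / 96 * (2 * (M : ℝ) + 1) ^ (d - 1) := by gcongr
        _ = _ := by rw [h5]; ring
    exact le_of_mul_le_mul_left h6 hMpos
  have habs : |e| ≤ 1 / 4 := abs_le_of_sq_le_sq (by linarith) (by norm_num)
  obtain ⟨e1, e2⟩ := abs_le.1 habs
  have hCinv : 1 / C ≤ 1 / 16 := one_div_le_one_div_of_le (by norm_num) hC16
  refine hCinv.trans ?_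
  rw [hf]
  split_ifs <;> nlinarith

end
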